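/- Let β ∈ ℂ and m ∈ ℂ with 2m ∉ ℤ. For x > 0 define ℋ^±_{β,m}(x) := e^{∓iπ(1/2+m)/2}·𝒦_{±iβ,m}(∓ix) (note ∓ix ∈ ℂ∖(−∞,0]). Then for every x > 0 the connection formula holds: 𝒥_{β,m}(x) = e^{−πβ}·( ℋ⁺_{β,m}(x)/Γ(1/2+m+iβ) + ℋ⁻_{β,m}(x)/Γ(1/2+m−iβ) ). -/

import Mathlib

/-- Pochhammer symbol `(a)_k = a (a+1) ⋯ (a+k-1)`. -/
noncomputable def poch (a : ℂ) (k : ℕ) : ℂ := ∏ i ∈ Finset.range k, (a + i)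

/-- Regularized confluent hypergeometric function
`₁𝐅₁(a;c;z) = Σ_{k=0}^∞ (a)_k z^k / (Γ(c+k)·k!)`. -/
noncomputable def regF1 (a c z : ℂ) : ℂ :=
  ∑' k : ℕ, poch a k * z ^ k / (Complex.Gamma (c + k) * (Nat.factorial k))

/-- The Whittaker-type function `ℐ_{β,m}(z) = z^{1/2+m} e^{-z/2} ₁𝐅₁(1/2+m-β; 1+2m; z)`. -/
noncomputable def WI (β m z : ℂ) : ℂ :=
  z ^ ((1 : ℂ) / 2 + m) * Complex.exp (-z / 2) * regF1 (1 / 2 + m - β) (1 + 2 * m) z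

/-- For `2m ∉ ℤ`, the Whittaker function
`𝒦_{β,m}(z) = −(π/sin(2πm)) (ℐ_{β,m}(z)/Γ(1/2−m−β) − ℐ_{β,−m}(z)/Γ(1/2+m−β))`. -/
noncomputable def WK (β m z : ℂ) : ℂ :=
  -((Real.pi : ℂ) / Complex.sin (2 * (Real.pi : ℂ) * m)) *
    (WI β m z / Complex.Gamma (1 / 2 - m - β) - WI β (-m) z / Complex.Gamma (1 / 2 + m - β))

/-- The function `𝒥_{β,m}(x) = x^{1/2+m} e^{-ix/2} ₁𝐅₁(1/2+m+iβ; 1+2m; ix)` for `x > 0`. -/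
noncomputable def WJ (β m : ℂ) (x : ℝ) : ℂ :=
  (x : ℂ) ^ ((1 : ℂ) / 2 + m) * Complex.exp (-(Complex.I * x) / 2) *
    regF1 (1 / 2 + m + Complex.I * β) (1 + 2 * m) (Complex.I * x)

/-- The function `ℋ⁺_{β,m}(x) = e^{−iπ(1/2+m)/2} 𝒦_{iβ,m}(−ix)`. -/
noncomputable def WHp (β m : ℂ) (x : ℝ) : ℂ :=
  Complex.exp (-(Complex.I * (Real.pi : ℂ) * (1 / 2 + m)) / 2) *
    WK (Complex.I * β) m (-(Complex.I * x))

/-- The function `ℋ⁻_{β,m}(x) = e^{iπ(1/2+m)/2} 𝒦_{−iβ,m}(ix)`. -/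
noncomputable def WHm (β m : ℂ) (x : ℝ) : ℂ :=
  Complex.exp (Complex.I * (Real.pi : ℂ) * (1 / 2 + m) / 2) *
    WK (-(Complex.I * β)) m (Complex.I * x)

theorem poch_succ (a : ℂ) (k : ℕ) : poch a (k + 1) = poch a k * (a + k) := by
  simp [poch, Finset.prod_range_succ]

theorem poch_succ_left (a : ℂ) (k : ℕ) : poch a (k + 1) = a * poch (a + 1) k := by
  simp only [poch, Finset.prod_range_succ', Nat.cast_zero, add_zero]
  rw [mul_comm]
  congr 1
  refine Finset.prod_congr rfl fun i _ => ?_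
  push_cast
  ring

open Finset in
/-- The Chu-Vandermonde identity for Pochhammer symbols. -/
theorem sum_antidiagonal_choose_mul_poch (n : ℕ) (b c : ℂ) :
    ∑ ij ∈ antidiagonal n,
      (n.choose ij.1 : ℂ) * ((-1) ^ ij.1 * poch b ij.1 * poch (c + ij.1) ij.2) =
        poch (c - b) n := by
  induction n generalizing b c with
  | zero => simp [poch]
  | succ n ih =>
    rw [sum_antidiagonal_choose_succ_mul
      (fun i j => (-1) ^ i * poch b i * poch (c + i) j) n]
    have h₁ : ∑ ij ∈ antidiagonal n, (n.choose ij.1 : ℂ) *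
        ((-1) ^ ij.1 * poch b ij.1 * poch (c + ij.1) (ij.2 + 1)) =
        (c + n) * poch (c - b) n := by
      rw [← ih b c, mul_sum]
      refine sum_congr rfl fun ij hij => ?_
      rw [poch_succ, ← mem_antidiagonal.mp hij]
      push_cast
      ring
    have h₂ : ∑ ij ∈ antidiagonal n, (n.choose ij.2 : ℂ) *
        ((-1) ^ (ij.1 + 1) * poch b (ij.1 + 1) * poch (c + (ij.1 + 1 : ℕ)) ij.2) =
        -b * poch (c - b) n := by
      rw [show c - b = (c + 1) - (b + 1) by ring, ← ih (b + 1) (c + 1), mul_sum]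
      refine sum_congr rfl fun ij hij => ?_
      rw [poch_succ_left, ← Nat.choose_symm_of_eq_add (mem_antidiagonal.mp hij).symm, pow_succ,
        show c + ((ij.1 + 1 : ℕ) : ℂ) = c + 1 + ij.1 by push_cast; ring]
      ring
    rw [h₁, h₂, poch_succ]
    ring

theorem Gamma_add_nat (c : ℂ) (hc : ∀ n : ℕ, c + n ≠ 0) (k : ℕ) :
    Complex.Gamma (c + k) = poch c k * Complex.Gamma c := by
  induction k with
  | zero => simp [poch]
  | succ k ih =>
    rw [poch_succ, Nat.cast_succ, ← add_assoc, Complex.Gamma_add_one _ (hc k), ih]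
    ring

/-- The series defining `regF1` converges absolutely. -/
theorem summable_norm_regF1 (a c z : ℂ) (hc : ∀ n : ℕ, c + n ≠ 0) :
    Summable fun k : ℕ =>
      ‖poch a k * z ^ k / (Complex.Gamma (c + k) * (Nat.factorial k))‖ := by
  have hlim : Filter.Tendsto (fun k : ℕ => (a + (1 : ℂ) * k) / (c + (1 : ℂ) * k) * (z / (k + 1)))
      Filter.atTop (nhds (1 / 1 * 0)) := by
    refine (tendsto_add_mul_div_add_mul_atTop_nhds a c 1 one_ne_zero).mul ?_
    simpa [div_eq_mul_inv] using
      (tendsto_one_div_add_atTop_nhds_zero_nat (𝕜 := ℂ)).const_mul z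
  have hev := (hlim.norm).eventually_lt_const (u := 1 / 2) (by norm_num)
  refine summable_of_ratio_norm_eventually_le (r := 1 / 2) (by norm_num) ?_
  filter_upwards [hev] with k hk
  rw [norm_norm, norm_norm]
  have hΓ : Complex.Gamma (c + (k + 1 : ℕ)) = (c + k) * Complex.Gamma (c + k) := by
    rw [Nat.cast_succ, ← add_assoc, Complex.Gamma_add_one _ (hc k)]
  have hstep : poch a (k + 1) * z ^ (k + 1) /
      (Complex.Gamma (c + (k + 1 : ℕ)) * (Nat.factorial (k + 1))) =
      ((a + (1 : ℂ) * k) / (c + (1 : ℂ) * k) * (z / (k + 1))) *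
        (poch a k * z ^ k / (Complex.Gamma (c + k) * (Nat.factorial k))) := by
    rw [hΓ, poch_succ, Nat.factorial_succ]
    push_cast
    simp only [one_mul, div_eq_mul_inv, mul_inv, pow_succ]
    ring
  rw [hstep, norm_mul]
  exact mul_le_mul_of_nonneg_right hk.le (norm_nonneg _)

open Finset in
/-- Kummer's transformation. -/
theorem exp_mul_regF1_neg (b c z : ℂ) (hc : ∀ n : ℕ, c + n ≠ 0) :
    Complex.exp z * regF1 b c (-z) = regF1 (c - b) c z := by
  have hΓ : ∀ k : ℕ, Complex.Gamma (c + k) ≠ 0 := fun k =>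
    Complex.Gamma_ne_zero fun m h => hc (k + m) (by push_cast; rw [← add_assoc, h]; ring)
  rw [mul_comm, Complex.exp_eq_exp_ℂ, NormedSpace.exp_eq_tsum_div, regF1, regF1,
    tsum_mul_tsum_eq_tsum_sum_antidiagonal_of_summable_norm (summable_norm_regF1 b c (-z) hc)
      (NormedSpace.norm_expSeries_div_summable z)]
  refine tsum_congr fun n => ?_
  rw [← sum_antidiagonal_choose_mul_poch, sum_mul, sum_div]
  refine sum_congr rfl fun ij hij => ?_
  obtain ⟨i, j⟩ := ij
  obtain rfl : i + j = n := mem_antidiagonal.mp hij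
  have hsplit : Complex.Gamma (c + (i + j : ℕ)) =
      poch (c + i) j * Complex.Gamma (c + i) := by
    rw [Nat.cast_add, ← add_assoc]
    exact Gamma_add_nat (c + i) (fun n => by simpa [add_assoc] using hc (i + n)) j
  have hp : poch (c + i) j ≠ 0 := left_ne_zero_of_mul (hsplit ▸ hΓ (i + j))
  have hch : ((i + j).choose i : ℂ) * (i.factorial * j.factorial) = (i + j).factorial := by
    have := Nat.choose_mul_factorial_mul_factorial (Nat.le_add_right i j)
    rw [Nat.add_sub_cancel_left, mul_assoc] at this
    exact_mod_cast this
  have hi : (i.factorial : ℂ) ≠ 0 := by exact_mod_cast i.factorial_ne_zero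
  have hj : (j.factorial : ℂ) ≠ 0 := by exact_mod_cast j.factorial_ne_zero
  have hn : ((i + j).choose i : ℂ) ≠ 0 := by
    exact_mod_cast (Nat.choose_pos (Nat.le_add_right i j)).ne'
  have := hΓ i
  rw [hsplit, ← hch, neg_pow]
  field_simp
  ring

theorem I_mul_ofReal_cpow {x : ℝ} (hx : 0 < x) (s : ℂ) :
    (Complex.I * x) ^ s = Complex.exp (Complex.I * Real.pi * s / 2) * (x : ℂ) ^ s := by
  have hx' : (x : ℂ) ≠ 0 := by exact_mod_cast hx.ne'
  rw [Complex.cpow_def_of_ne_zero (mul_ne_zero Complex.I_ne_zero hx'),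
    Complex.cpow_def_of_ne_zero hx', mul_comm Complex.I (x : ℂ),
    Complex.log_ofReal_mul hx Complex.I_ne_zero, Complex.log_I, Complex.ofReal_log hx.le,
    ← Complex.exp_add]
  congr 1
  ring

theorem neg_I_mul_ofReal_cpow {x : ℝ} (hx : 0 < x) (s : ℂ) :
    (-(Complex.I * x)) ^ s = Complex.exp (-(Complex.I * Real.pi * s) / 2) * (x : ℂ) ^ s := by
  have hx' : (x : ℂ) ≠ 0 := by exact_mod_cast hx.ne'
  rw [Complex.cpow_def_of_ne_zero (neg_ne_zero.mpr (mul_ne_zero Complex.I_ne_zero hx')),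
    Complex.cpow_def_of_ne_zero hx', show -(Complex.I * (x : ℂ)) = x * -Complex.I by ring,
    Complex.log_ofReal_mul hx (neg_ne_zero.mpr Complex.I_ne_zero), Complex.log_neg_I,
    Complex.ofReal_log hx.le, ← Complex.exp_add]
  congr 1
  ring

theorem WI_I_mul (β m : ℂ) {x : ℝ} (hx : 0 < x) :
    WI (-(Complex.I * β)) m (Complex.I * x) =
      Complex.exp (Complex.I * Real.pi * (1 / 2 + m) / 2) * WJ β m x := by
  rw [WI, WJ, I_mul_ofReal_cpow hx, sub_neg_eq_add]
  ring

theorem WI_neg_I_mul (β m : ℂ) (hm : ∀ n : ℤ, 2 * m ≠ n) {x : ℝ} (hx : 0 < x) :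
    WI (Complex.I * β) m (-(Complex.I * x)) =
      Complex.exp (-(Complex.I * Real.pi * (1 / 2 + m)) / 2) * WJ β m x := by
  have hc : ∀ n : ℕ, 1 + 2 * m + n ≠ 0 := fun n h =>
    hm (-1 - n) (by push_cast; linear_combination h)
  have hK := exp_mul_regF1_neg (1 / 2 + m - Complex.I * β) (1 + 2 * m) (Complex.I * x) hc
  rw [show 1 + 2 * m - (1 / 2 + m - Complex.I * β) = 1 / 2 + m + Complex.I * β by ring] at hK
  rw [WI, WJ, neg_I_mul_ofReal_cpow hx, ← hK, neg_neg]
  have hexp : Complex.exp (Complex.I * x / 2) =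
      Complex.exp (-(Complex.I * x) / 2) * Complex.exp (Complex.I * x) := by
    rw [← Complex.exp_add]
    congr 1
    ring
  rw [hexp]
  ring

/-- Euler's reflection formula for the reciprocal Gamma function. -/
theorem inv_Gamma_mul_inv_Gamma_of_add_eq_one {z w : ℂ} (h : z + w = 1) :
    (Complex.Gamma z)⁻¹ * (Complex.Gamma w)⁻¹ = Complex.sin (Real.pi * z) / Real.pi := by
  rw [← mul_inv, eq_sub_of_add_eq' h, Complex.Gamma_mul_Gamma_one_sub, inv_div]

theorem exp_neg_mul_sin_add_add_exp_mul_sin_sub (A B : ℂ) :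
    Complex.exp (-(Complex.I * A)) * Complex.sin (A + B) +
      Complex.exp (Complex.I * A) * Complex.sin (A - B) =
        Complex.exp (-(Complex.I * B)) * Complex.sin (2 * A) := by
  have key : ∀ u v : ℂ, Complex.exp u * Complex.sin v =
      (Complex.exp (u - v * Complex.I) - Complex.exp (u + v * Complex.I)) * Complex.I / 2 := by
    intro u v
    rw [Complex.sin, sub_eq_add_neg u, Complex.exp_add, Complex.exp_add, neg_mul]
    ring
  rw [key, key, key]
  ring_nf

/-- Connection formula: for `2m ∉ ℤ` and every `x > 0`,
`𝒥_{β,m}(x) = e^{−πβ} (ℋ⁺_{β,m}(x)/Γ(1/2+m+iβ) + ℋ⁻_{β,m}(x)/Γ(1/2+m−iβ))`. -/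
theorem WJ_connection_formula (β m : ℂ) (hm : ∀ n : ℤ, 2 * m ≠ (n : ℂ)) :
    ∀ x : ℝ, 0 < x →
      WJ β m x =
        Complex.exp (-(Real.pi : ℂ) * β) *
          (WHp β m x / Complex.Gamma (1 / 2 + m + Complex.I * β) +
           WHm β m x / Complex.Gamma (1 / 2 + m - Complex.I * β)) := by
  intro x hx
  have hm' : ∀ n : ℤ, 2 * -m ≠ (n : ℂ) := fun n h =>
    hm (-n) (by push_cast; linear_combination -h)
  have hsin : Complex.sin (2 * (Real.pi : ℂ) * m) ≠ 0 := by
    rw [Complex.sin_ne_zero_iff]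
    intro k hk
    refine hm k (mul_left_cancel₀ (Complex.ofReal_ne_zero.mpr Real.pi_ne_zero) ?_)
    linear_combination hk
  have hπ : (Real.pi : ℂ) ≠ 0 := Complex.ofReal_ne_zero.mpr Real.pi_ne_zero
  have hΓ₁ := inv_Gamma_mul_inv_Gamma_of_add_eq_one
    (show (1 / 2 + m + Complex.I * β) + (1 / 2 - m - Complex.I * β) = 1 by ring)
  have hΓ₂ := inv_Gamma_mul_inv_Gamma_of_add_eq_one
    (show (1 / 2 + m - Complex.I * β) + (1 / 2 - m + Complex.I * β) = 1 by ring)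
  have htrig := exp_neg_mul_sin_add_add_exp_mul_sin_sub (Real.pi * (1 / 2 + m))
    (Real.pi * (Complex.I * β))
  rw [← mul_add, ← mul_sub, show -(Complex.I * (Real.pi * (Complex.I * β))) = Real.pi * β by
      linear_combination (-Real.pi * β) * Complex.I_sq,
    show 2 * (Real.pi * (1 / 2 + m)) = 2 * Real.pi * m + Real.pi by ring,
    Complex.sin_add_pi] at htrig
  have hβ : Complex.exp (-(Real.pi : ℂ) * β) * Complex.exp (Real.pi * β) = 1 := by
    rw [← Complex.exp_add, neg_mul, neg_add_cancel, Complex.exp_zero]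
  have hE₁ : Complex.exp (-(Complex.I * Real.pi * (1 / 2 + m)) / 2) *
      Complex.exp (-(Complex.I * Real.pi * (1 / 2 + m)) / 2) =
        Complex.exp (-(Complex.I * (Real.pi * (1 / 2 + m)))) := by
    rw [← Complex.exp_add]
    congr 1
    ring
  have hE₂ : Complex.exp (Complex.I * Real.pi * (1 / 2 + m) / 2) *
      Complex.exp (Complex.I * Real.pi * (1 / 2 + m) / 2) =
        Complex.exp (Complex.I * (Real.pi * (1 / 2 + m))) := by
    rw [← Complex.exp_add]
    congr 1
    ring
  have hF₁ : Complex.exp (-(Complex.I * Real.pi * (1 / 2 + m)) / 2) *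
      Complex.exp (-(Complex.I * Real.pi * (1 / 2 + -m)) / 2) = -Complex.I := by
    rw [← Complex.exp_add, ← Complex.exp_neg_pi_div_two_mul_I]
    congr 1
    ring
  have hF₂ : Complex.exp (Complex.I * Real.pi * (1 / 2 + m) / 2) *
      Complex.exp (Complex.I * Real.pi * (1 / 2 + -m) / 2) = Complex.I := by
    rw [← Complex.exp_add]
    refine Eq.trans (congrArg Complex.exp ?_) Complex.exp_pi_div_two_mul_I
    ring
  rw [WHp, WHm, WK, WK, WI_I_mul β m hx, WI_I_mul β (-m) hx, WI_neg_I_mul β m hm hx,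
    WI_neg_I_mul β (-m) hm' hx, sub_neg_eq_add, sub_neg_eq_add]
  simp only [div_eq_mul_inv _ (Complex.Gamma _)]
  generalize Complex.exp (-(Complex.I * Real.pi * (1 / 2 + m)) / 2) = e₁ at *
  generalize Complex.exp (Complex.I * Real.pi * (1 / 2 + m) / 2) = e₂ at *
  generalize Complex.exp (-(Complex.I * Real.pi * (1 / 2 + -m)) / 2) = f₁ at *
  generalize Complex.exp (Complex.I * Real.pi * (1 / 2 + -m) / 2) = f₂ at *
  generalize (Complex.Gamma (1 / 2 + m + Complex.I * β))⁻¹ = g₁ at *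
  generalize (Complex.Gamma (1 / 2 - m - Complex.I * β))⁻¹ = h₁ at *
  generalize (Complex.Gamma (1 / 2 + m - Complex.I * β))⁻¹ = g₂ at *
  generalize (Complex.Gamma (1 / 2 - m + Complex.I * β))⁻¹ = h₂ at *
  rw [← hE₁, ← hE₂] at htrig
  rw [eq_div_iff hπ] at hΓ₁ hΓ₂
  rw [← hΓ₁, ← hΓ₂] at htrig
  generalize Complex.sin (2 * Real.pi * m) = s at *
  generalize Complex.exp (-(Real.pi : ℂ) * β) = q at *
  generalize Complex.exp (Real.pi * β) = r at *
  generalize WJ β m x = J at *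
  generalize WJ β (-m) x = K at *
  field_simp
  linear_combination (q * J) * htrig - s * J * hβ
    - q * K * Real.pi * g₁ * g₂ * (hF₁ + hF₂)
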